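/- Let F be a real symplectic 2d×2d matrix, written in block form with d×d blocks ∂_q Q, ∂_p Q, ∂_q P, ∂_p P (i.e., F^T J F = J where J is the standard symplectic matrix). Define the complex d×d matrix Z = (∂_q − i∂_p)(Q + iP), i.e., Z = ∂_q Q + ∂_p P + i(∂_q P − ∂_p Q). Then Z Z* = M + 2·Id where M is a positive semidefinite Hermitian matrix (namely M = (iI, I) F^T F (−iI; I)); consequently v* Z Z* v ≥ 2|v|² for all v ∈ ℂ^d, and Z is invertible. -/

import Mathlib

open Matrix Complex

lemma Z_key {d : ℕ} (a b c e aa bt ct et : Matrix (Fin d) (Fin d) ℂ)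
    (h1 : a * ct = c * aa) (h2 : a * et = 1 + c * bt) (h3 : b * et = e * bt)
    (h4 : e * aa = 1 + b * ct) :
    (a + e + Complex.I • (c - b)) * (aa + et - Complex.I • (ct - bt)) =
      (a - Complex.I • b) * (aa + Complex.I • bt) + (c - Complex.I • e) * (ct + Complex.I • et)
        + (2 : ℂ) • (1 : Matrix (Fin d) (Fin d) ℂ) := by
  simp only [mul_add, add_mul, mul_sub, sub_mul, smul_mul_assoc, mul_smul_comm, smul_sub, smul_smul,
    Complex.I_mul_I, h1, h2, h3, h4, smul_add]
  module

open scoped ComplexOrder in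
lemma re_form {d : ℕ} (P : Matrix (Fin d) (Fin d) ℂ) (v : Fin d → ℂ) :
    0 ≤ (star v ⬝ᵥ ((P * Pᴴ).mulVec v)).re :=
  (Complex.le_def.1 ((Matrix.posSemidef_self_mul_conjTranspose P).dotProduct_mulVec_nonneg v)).1

/-- For a real symplectic matrix `F` with block structure
`F = [[Aᵀ, Bᵀ], [Cᵀ, Dᵀ]]`, the complex matrix `Z = A + D + i (C - B)`
satisfies `v* (Z Z*) v ≥ 2 |v|²` for all `v ∈ ℂ^d`; in particular `Z` is
invertible. -/
theorem symplectic_Z_lower_bound {d : ℕ} (hd : 1 ≤ d)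
    (A B C D : Matrix (Fin d) (Fin d) ℝ)
    (hsymp :
      (Matrix.fromBlocks Aᵀ Bᵀ Cᵀ Dᵀ)ᵀ *
          Matrix.fromBlocks (0 : Matrix (Fin d) (Fin d) ℝ) 1 (-1) 0 *
          Matrix.fromBlocks Aᵀ Bᵀ Cᵀ Dᵀ
        = Matrix.fromBlocks (0 : Matrix (Fin d) (Fin d) ℝ) 1 (-1) 0) :
    (∀ v : Fin d → ℂ,
        2 * (∑ i, Complex.normSq (v i)) ≤
          ((star v) ⬝ᵥ
            ((((A + D).map (Complex.ofReal) + Complex.I • (C - B).map (Complex.ofReal)) *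
              ((A + D).map (Complex.ofReal) + Complex.I • (C - B).map (Complex.ofReal))ᴴ).mulVec v)).re)
      ∧ IsUnit ((A + D).map (Complex.ofReal) + Complex.I • (C - B).map (Complex.ofReal)) := by
  have e1 : (Matrix.fromBlocks Aᵀ Bᵀ Cᵀ Dᵀ)ᵀ = Matrix.fromBlocks A C B D := by
    simp [Matrix.fromBlocks_transpose]
  rw [e1, Matrix.fromBlocks_multiply, Matrix.fromBlocks_multiply, Matrix.fromBlocks_inj] at hsymp
  simp only [mul_zero, mul_one, mul_neg, zero_add, add_zero, neg_mul] at hsymp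
  obtain ⟨h1, h2, h4, h3⟩ := hsymp
  have tr : ∀ X : Matrix (Fin d) (Fin d) ℝ,
      (X.map Complex.ofReal)ᴴ = Xᵀ.map Complex.ofReal := by
    intro X; ext i j; simp
  have mm : ∀ X Y : Matrix (Fin d) (Fin d) ℝ,
      X.map Complex.ofReal * Y.map Complex.ofReal = (X * Y).map Complex.ofReal := by
    intro X Y; ext i j; simp [Matrix.mul_apply]
  have ma : ∀ X Y : Matrix (Fin d) (Fin d) ℝ,
      (X + Y).map Complex.ofReal = X.map Complex.ofReal + Y.map Complex.ofReal := by
    intro X Y; ext i j; simp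
  have ms : ∀ X Y : Matrix (Fin d) (Fin d) ℝ,
      (X - Y).map Complex.ofReal = X.map Complex.ofReal - Y.map Complex.ofReal := by
    intro X Y; ext i j; simp
  have m1 : (1 : Matrix (Fin d) (Fin d) ℝ).map Complex.ofReal = 1 := by
    ext i j; by_cases h : i = j <;> simp [Matrix.one_apply, h]
  have key := Z_key (A.map Complex.ofReal) (B.map Complex.ofReal) (C.map Complex.ofReal)
    (D.map Complex.ofReal) (Aᵀ.map Complex.ofReal) (Bᵀ.map Complex.ofReal)
    (Cᵀ.map Complex.ofReal) (Dᵀ.map Complex.ofReal)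
    (by rw [mm, mm]; congr 1; rw [neg_add_eq_zero] at h1; exact h1.symm)
    (by rw [mm, mm, ← m1, ← ma]; congr 1; rw [← h2]; abel)
    (by rw [mm, mm]; congr 1; rw [neg_add_eq_zero] at h3; exact h3.symm)
    (by rw [mm, mm, ← m1, ← ma]; congr 1; rw [← neg_neg (1 : Matrix (Fin d) (Fin d) ℝ), ← h4]; abel)
  have hP : ∀ X Y : Matrix (Fin d) (Fin d) ℝ,
      Xᵀ.map Complex.ofReal + Complex.I • Yᵀ.map Complex.ofReal =
        (X.map Complex.ofReal - Complex.I • Y.map Complex.ofReal)ᴴ := by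
    intro X Y; ext i j; simp
  have hZ : Aᵀ.map Complex.ofReal + Dᵀ.map Complex.ofReal
      - Complex.I • (Cᵀ.map Complex.ofReal - Bᵀ.map Complex.ofReal) =
        ((A + D).map Complex.ofReal + Complex.I • (C - B).map Complex.ofReal)ᴴ := by
    ext i j; simp; ring
  rw [hP, hP, hZ, ← ma, ← ms] at key
  have main : ∀ v : Fin d → ℂ,
        2 * (∑ i, Complex.normSq (v i)) ≤
          ((star v) ⬝ᵥ
            ((((A + D).map (Complex.ofReal) + Complex.I • (C - B).map (Complex.ofReal)) *
              ((A + D).map (Complex.ofReal)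
                + Complex.I • (C - B).map (Complex.ofReal))ᴴ).mulVec v)).re := by
    intro v
    rw [key, Matrix.add_mulVec, Matrix.add_mulVec, dotProduct_add, dotProduct_add, Complex.add_re,
      Complex.add_re]
    have q1 := re_form (A.map Complex.ofReal - Complex.I • B.map Complex.ofReal) v
    have q2 := re_form (C.map Complex.ofReal - Complex.I • D.map Complex.ofReal) v
    have q3 : (star v ⬝ᵥ (((2 : ℂ) • (1 : Matrix (Fin d) (Fin d) ℂ)).mulVec v)).re
        = 2 * (∑ i, Complex.normSq (v i)) := by
      rw [Matrix.smul_mulVec, Matrix.one_mulVec, dotProduct_smul]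
      simp [dotProduct, Complex.normSq_apply]
    linarith
  refine ⟨main, ?_⟩
  generalize (A + D).map Complex.ofReal + Complex.I • (C - B).map Complex.ofReal = Z at main
  rw [← Matrix.isUnit_conjTranspose, ← Matrix.mulVec_injective_iff_isUnit]
  refine (injective_iff_map_eq_zero (Matrix.mulVecLin Zᴴ)).2 ?_
  intro v hv
  have hm := main v
  rw [← Matrix.mulVec_mulVec, show Zᴴ.mulVec v = 0 from hv] at hm
  simp only [Matrix.mulVec_zero, dotProduct_zero, Complex.zero_re] at hm
  have hs : ∑ i, Complex.normSq (v i) = 0 :=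
    le_antisymm (by linarith) (Finset.sum_nonneg fun i _ => Complex.normSq_nonneg _)
  rw [Finset.sum_eq_zero_iff_of_nonneg fun i _ => Complex.normSq_nonneg _] at hs
  funext i
  exact Complex.normSq_eq_zero.1 (hs i (Finset.mem_univ i))
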